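/- (Property A) Let B be a nonunital σ-unital simple C*-algebra and let (e_n) be an approximate unit for B satisfying e_{n+1} e_n = e_n for all n ≥ 1 (with e_0 := 0 and r_n := e_n − e_{n−1}). For every Laurent polynomial h, every contractive X ∈ 𝓜(B), every ε > 0 and every M ≥ 1, there exists L₁ ≥ 1 such that: for all sequences (α_j) and (α'_j) in the closed unit ball of ℂ with α_j = α'_j for all j ≥ M, if Y and Y' are the strict sums of Σ_{j=1}^∞ α_j r_j and Σ_{j=1}^∞ α'_j r_j respectively, then ‖h(Y X)(1 − e_{L₁}) − h(Y' X)(1 − e_{L₁})‖ < ε. -/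

import Mathlib

open scoped MultiplierAlgebra

/-- `(e n)` is a (sequential) approximate unit for `B`: positive contractions with
`‖e n * b - b‖ → 0` and `‖b * e n - b‖ → 0` for every `b ∈ B`. -/
def IsApproximateUnit {B : Type*} [NonUnitalCStarAlgebra B] [PartialOrder B]
    [StarOrderedRing B] (e : ℕ → B) : Prop :=
  (∀ n, 0 ≤ e n) ∧ (∀ n, ‖e n‖ ≤ 1) ∧
    (∀ b : B, Filter.Tendsto (fun n => ‖e n * b - b‖) Filter.atTop (nhds 0)) ∧
    (∀ b : B, Filter.Tendsto (fun n => ‖b * e n - b‖) Filter.atTop (nhds 0))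

/-- The series `Σ_{j=1}^∞ b j` converges strictly to `Y` in the multiplier algebra
`𝓜(ℂ, B)`. -/
def StrictlySumsTo {B : Type*} [NonUnitalCStarAlgebra B] (b : ℕ → B) (Y : 𝓜(ℂ, B)) : Prop :=
  ∀ x : B,
    Filter.Tendsto (fun N => (↑(∑ j ∈ Finset.Icc 1 N, b j) : 𝓜(ℂ, B)) * (x : 𝓜(ℂ, B)))
      Filter.atTop (nhds (Y * (x : 𝓜(ℂ, B)))) ∧
    Filter.Tendsto (fun N => (x : 𝓜(ℂ, B)) * (↑(∑ j ∈ Finset.Icc 1 N, b j) : 𝓜(ℂ, B)))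
      Filter.atTop (nhds ((x : 𝓜(ℂ, B)) * Y))

/-- Evaluation of the Laurent polynomial
`h(λ) = Σ_{n=0}^{N} β n λ^n + Σ_{m=1}^{M} γ m λ̄^m` at an element `x` of a unital
complex star algebra: `h(x) = Σ_{n=0}^{N} β n • x^n + Σ_{m=1}^{M} γ m • (x⋆)^m`. -/
def laurentEval {A : Type*} [Ring A] [StarRing A] [Module ℂ A]
    (N M : ℕ) (β γ : ℕ → ℂ) (x : A) : A :=
  (∑ n ∈ Finset.range (N + 1), β n • x ^ n) + ∑ m ∈ Finset.Icc 1 M, γ m • star x ^ m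

section UniformVanishing

variable {A ι κ : Type*} [NormedRing A] {E : ℕ → A} {S T R Z Z' : ι → A}

/-- The family `T` is bounded and `T i * (1 - E l)` tends to `0` in norm as `l → ∞`,
uniformly in `i`. -/
def VanishesUniformly (E : ℕ → A) (T : ι → A) : Prop :=
  (∃ C, ∀ i, ‖T i‖ ≤ C) ∧ ∀ ε > 0, ∃ L, ∀ l ≥ L, ∀ i, ‖T i * (1 - E l)‖ ≤ ε

/-- The family `R` is bounded and each `E N * R i` vanishes uniformly. Right multiplication by
such families preserves uniform vanishing. -/
def CompatibleWith (E : ℕ → A) (R : ι → A) : Prop :=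
  (∃ C, ∀ i, ‖R i‖ ≤ C) ∧ ∀ N, VanishesUniformly E (fun i => E N * R i)

namespace VanishesUniformly

theorem zero : VanishesUniformly E (fun _ : ι => 0) :=
  ⟨⟨0, fun _ => by simp⟩, fun ε hε => ⟨0, fun l _ i => by simpa using hε.le⟩⟩

theorem add (hS : VanishesUniformly E S) (hT : VanishesUniformly E T) :
    VanishesUniformly E (fun i => S i + T i) := by
  obtain ⟨⟨C, hC⟩, hS⟩ := hS
  obtain ⟨⟨D, hD⟩, hT⟩ := hT
  refine ⟨⟨C + D, fun i => norm_add_le_of_le (hC i) (hD i)⟩, fun ε hε => ?_⟩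
  obtain ⟨L, hL⟩ := hS (ε / 2) (by positivity)
  obtain ⟨L', hL'⟩ := hT (ε / 2) (by positivity)
  refine ⟨max L L', fun l hl i => ?_⟩
  rw [add_mul, ← add_halves ε]
  exact norm_add_le_of_le (hL l (le_of_max_le_left hl) i) (hL' l (le_of_max_le_right hl) i)

theorem sum (s : Finset κ) {F : κ → ι → A} (hF : ∀ k, VanishesUniformly E (F k)) :
    VanishesUniformly E (fun i => ∑ k ∈ s, F k i) := by
  classical
  induction s using Finset.induction_on with
  | empty => simpa using zero
  | insert k s hk ih => simpa only [Finset.sum_insert hk] using (hF k).add ih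

theorem mul_left (hT : VanishesUniformly E T) (hS : ∃ C, ∀ i, ‖S i‖ ≤ C) :
    VanishesUniformly E (fun i => S i * T i) := by
  obtain ⟨⟨C, hC⟩, hT⟩ := hT
  obtain ⟨D, hD⟩ := hS
  refine ⟨⟨D * C, fun i => norm_mul_le_of_le (hD i) (hC i)⟩, fun ε hε => ?_⟩
  obtain ⟨L, hL⟩ := hT (ε / (|D| + 1)) (by positivity)
  refine ⟨L, fun l hl i => ?_⟩
  rw [mul_assoc]
  calc _ ≤ (|D| + 1) * (ε / (|D| + 1)) :=
        norm_mul_le_of_le (by linarith [hD i, le_abs_self D]) (hL l hl i)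
    _ = ε := by field_simp

theorem smul [NormedAlgebra ℂ A] (c : ℂ) (hT : VanishesUniformly E T) :
    VanishesUniformly E (fun i => c • T i) := by
  simpa only [smul_mul_assoc, one_mul] using
    hT.mul_left (S := fun _ => c • (1 : A)) ⟨_, fun _ => le_rfl⟩

theorem mul_right {K : ℝ} (hK : ∀ l, ‖1 - E l‖ ≤ K) (hT : VanishesUniformly E T)
    (hR : CompatibleWith E R) : VanishesUniformly E (fun i => T i * R i) := by
  obtain ⟨⟨C, hC⟩, hT'⟩ := id hT
  obtain ⟨⟨D, hD⟩, hR⟩ := hR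
  refine ⟨⟨C * D, fun i => norm_mul_le_of_le (hC i) (hD i)⟩, fun ε hε => ?_⟩
  have hK0 : 0 ≤ K := (norm_nonneg _).trans (hK 0)
  obtain ⟨N, hN⟩ := hT' (ε / 2 / ((|D| + 1) * (K + 1))) (by positivity)
  obtain ⟨L, hL⟩ := ((hR N).mul_left ⟨C, hC⟩).2 (ε / 2) (by positivity)
  refine ⟨L, fun l hl i => ?_⟩
  have split : T i * R i * (1 - E l) =
      T i * (1 - E N) * (R i * (1 - E l)) + T i * (E N * R i) * (1 - E l) := by noncomm_ring
  rw [split, ← add_halves ε]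
  refine norm_add_le_of_le ?_ (hL l hl i)
  calc _ ≤ ε / 2 / ((|D| + 1) * (K + 1)) * ((|D| + 1) * (K + 1)) :=
        norm_mul_le_of_le (hN N le_rfl i) (norm_mul_le_of_le
          (by linarith [hD i, le_abs_self D]) (by linarith [hK l]))
    _ = ε / 2 := by field_simp

theorem pow_sub_pow {K : ℝ} (hK : ∀ l, ‖1 - E l‖ ≤ K)
    (h : VanishesUniformly E (fun i => Z i - Z' i)) (hZ : ∃ C, ∀ i, ‖Z i‖ ≤ C)
    (hZ' : CompatibleWith E Z') (n : ℕ) :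
    VanishesUniformly E (fun i => Z i ^ n - Z' i ^ n) := by
  induction n with
  | zero => simpa using zero
  | succ n ih =>
    have hb : ∃ C, ∀ i, ‖Z i ^ n‖ ≤ C := by
      obtain ⟨C, hC⟩ := hZ
      refine ⟨max ‖(1 : A)‖ (C ^ n), fun i => ?_⟩
      rcases Nat.eq_zero_or_pos n with rfl | hn
      · simp
      · exact le_max_of_le_right
          ((norm_pow_le' _ hn).trans (pow_le_pow_left₀ (norm_nonneg _) (hC i) n))
    convert (h.mul_left hb).add (ih.mul_right hK hZ') using 2
    noncomm_ring

theorem laurentEval_sub [StarRing A] [NormedAlgebra ℂ A] {K : ℝ} (hK : ∀ l, ‖1 - E l‖ ≤ K)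
    (h : VanishesUniformly E (fun i => Z i - Z' i)) (hZ : ∃ C, ∀ i, ‖Z i‖ ≤ C)
    (hZ' : CompatibleWith E Z')
    (hs : VanishesUniformly E (fun i => star (Z i) - star (Z' i)))
    (hsZ : ∃ C, ∀ i, ‖star (Z i)‖ ≤ C) (hsZ' : CompatibleWith E (fun i => star (Z' i)))
    (N M : ℕ) (β γ : ℕ → ℂ) :
    VanishesUniformly E (fun i => laurentEval N M β γ (Z i) - laurentEval N M β γ (Z' i)) := by
  convert (sum (Finset.range (N + 1)) fun n => (h.pow_sub_pow hK hZ hZ' n).smul (β n)).add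
    (sum (Finset.Icc 1 M) fun m => (hs.pow_sub_pow hK hsZ hsZ' m).smul (γ m)) using 2
  simp only [laurentEval, smul_sub, Finset.sum_sub_distrib]
  abel

end VanishesUniformly

theorem CompatibleWith.mul {K : ℝ} (hK : ∀ l, ‖1 - E l‖ ≤ K) (hS : CompatibleWith E S)
    (hR : CompatibleWith E R) : CompatibleWith E (fun i => S i * R i) := by
  obtain ⟨C, hC⟩ := hS.1
  obtain ⟨D, hD⟩ := hR.1
  refine ⟨⟨C * D, fun i => norm_mul_le_of_le (hC i) (hD i)⟩, fun N => ?_⟩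
  simpa only [mul_assoc] using (hS.2 N).mul_right hK hR

end UniformVanishing

namespace DoubleCentralizer

variable {B : Type*} [NonUnitalCStarAlgebra B]

theorem coe_mul' (a b : B) : ((a * b : B) : 𝓜(ℂ, B)) = a * b :=
  map_mul (coeHom (𝕜 := ℂ) (A := B)) a b

theorem coe_sub' (a b : B) : ((a - b : B) : 𝓜(ℂ, B)) = a - b :=
  map_sub (coeHom (𝕜 := ℂ) (A := B)) a b

theorem coe_zero' : ((0 : B) : 𝓜(ℂ, B)) = 0 :=
  map_zero (coeHom (𝕜 := ℂ) (A := B))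

theorem coe_star' (a : B) : ((star a : B) : 𝓜(ℂ, B)) = star (a : 𝓜(ℂ, B)) :=
  map_star (coeHom (𝕜 := ℂ) (A := B)) a

theorem norm_coe' (a : B) : ‖(a : 𝓜(ℂ, B))‖ = ‖a‖ := by
  rw [← norm_fst, coe_fst]
  exact ContinuousLinearMap.opNorm_mul_apply ℂ B a

theorem mul_coe' (T : 𝓜(ℂ, B)) (a : B) : T * (a : 𝓜(ℂ, B)) = ((T.fst a : B) : 𝓜(ℂ, B)) := by
  have h := T.central
  refine ext _ _ _ _ (Prod.ext ?_ ?_) <;> ext x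
  · change T.fst (a * x) = T.fst a * x
    refine sub_eq_zero.1 (CStarRing.star_mul_self_eq_zero_iff _ |>.1 ?_)
    rw [mul_sub, ← h, ← mul_assoc, ← mul_assoc, ← h, sub_self]
  · exact h x a

theorem coe_mul_eq_coe (a : B) (T : 𝓜(ℂ, B)) :
    (a : 𝓜(ℂ, B)) * T = ((T.snd a : B) : 𝓜(ℂ, B)) := by
  rw [← star_star ((a : 𝓜(ℂ, B)) * T), star_mul, ← coe_star', mul_coe', ← coe_star', star_fst,
    star_star, star_star]

theorem norm_le_of_forall_mul_coe {T : 𝓜(ℂ, B)} {C : ℝ} (hC : 0 ≤ C)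
    (h : ∀ x : B, ‖T * (x : 𝓜(ℂ, B))‖ ≤ C * ‖x‖) : ‖T‖ ≤ C := by
  rw [← norm_fst]
  refine ContinuousLinearMap.opNorm_le_bound _ hC fun x => ?_
  simpa only [mul_coe', norm_coe'] using h x

end DoubleCentralizer

section ApproximateUnit

open DoubleCentralizer

variable {B : Type*} [NonUnitalCStarAlgebra B] [PartialOrder B] [StarOrderedRing B]
  {e : ℕ → B} {α α' : ℕ → ℂ} {Y Y' : 𝓜(ℂ, B)}

theorem IsApproximateUnit.mul_eq_left (he : IsApproximateUnit e) (he0 : e 0 = 0)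
    (hee : ∀ n ≥ 1, e (n + 1) * e n = e n) {m n : ℕ} (h : m < n) : e m * e n = e m := by
  have hsa (k : ℕ) : star (e k) = e k := (he.1 k).isSelfAdjoint
  have hsucc (k : ℕ) : e k * e (k + 1) = e k := by
    rcases Nat.eq_zero_or_pos k with rfl | hk
    · simp [he0]
    · simpa [hsa] using congrArg star (hee k hk)
  induction n, h using Nat.le_induction with
  | base => exact hsucc m
  | succ n _ ih => rw [← ih, mul_assoc, hsucc]

theorem IsApproximateUnit.le_succ (he : IsApproximateUnit e) (he0 : e 0 = 0)
    (hee : ∀ n ≥ 1, e (n + 1) * e n = e n) (n : ℕ) : e n ≤ e (n + 1) := by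
  have hsa (k : ℕ) : IsSelfAdjoint (e k) := (he.1 k).isSelfAdjoint
  have hr : e n * e (n + 1) = e n := he.mul_eq_left he0 hee n.lt_succ_self
  have norm_smul_le {b : B} (hb : 0 ≤ b) (k : ℕ) : ‖e k‖ • b ≤ b := by
    simpa only [one_smul] using smul_le_smul_of_nonneg_right (he.2.1 k) hb
  have hl : e (n + 1) * e n = e n := by
    simpa [(hsa _).star_eq] using congrArg star hr
  have h1 : e n ≤ e (n + 1) * e (n + 1) := by
    have := CStarAlgebra.star_left_conjugate_le_norm_smul (a := e (n + 1)) (b := e n) (hsa n)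
    rw [(hsa _).star_eq, hl, hr] at this
    exact this.trans (norm_smul_le ((hsa (n + 1)).mul_self_nonneg) n)
  have h2 : e (n + 1) * e (n + 1) ≤ e (n + 1) := by
    obtain ⟨s, hs, hss⟩ : ∃ s : B, 0 ≤ s ∧ s * s = e (n + 1) :=
      ⟨_, CFC.sqrt_nonneg _, CFC.sqrt_mul_sqrt_self _ (he.1 _)⟩
    have := CStarAlgebra.star_left_conjugate_le_norm_smul (a := s) (b := e (n + 1)) (hsa _)
    rw [hs.isSelfAdjoint.star_eq, hss] at this
    have hcomm : s * e (n + 1) * s = e (n + 1) * e (n + 1) := by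
      simp only [← hss, mul_assoc]
    rw [hcomm] at this
    exact this.trans (norm_smul_le (he.1 _) _)
  exact h1.trans h2

theorem IsApproximateUnit.norm_sum_le (he : IsApproximateUnit e) (he0 : e 0 = 0)
    (hee : ∀ n ≥ 1, e (n + 1) * e n = e n) (hα : ∀ j, ‖α j‖ ≤ 1) (N : ℕ) :
    ‖∑ j ∈ Finset.Icc 1 N, α j • (e j - e (j - 1))‖ ≤ 6 := by
  have hpos (j : ℕ) : 0 ≤ e j - e (j - 1) := by
    rcases j with _ | j
    · simp
    · exact sub_nonneg.2 (he.le_succ he0 hee j)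
  have htel : ∑ j ∈ Finset.Icc 1 N, (e j - e (j - 1)) = e N := by
    induction N with
    | zero => simp [he0]
    | succ N ih => rw [Finset.sum_Icc_succ_top (by omega), ih]; simp
  have hreal (c : ℕ → ℝ) (hc : ∀ j, |c j| ≤ 1) :
      ‖∑ j ∈ Finset.Icc 1 N, (c j + 1) • (e j - e (j - 1))‖ ≤ 2 := by
    have hle : ∑ j ∈ Finset.Icc 1 N, (c j + 1) • (e j - e (j - 1)) ≤ (2 : ℝ) • e N := by
      rw [← htel, Finset.smul_sum]
      refine Finset.sum_le_sum fun j _ => smul_le_smul_of_nonneg_right ?_ (hpos j)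
      linarith [(abs_le.1 (hc j)).2]
    refine (CStarAlgebra.norm_le_norm_of_nonneg_of_le (Finset.sum_nonneg fun j _ =>
      smul_nonneg (by linarith [(abs_le.1 (hc j)).1]) (hpos j)) hle).trans ?_
    rw [norm_smul]
    norm_num
    exact he.2.1 N
  have hsplit : ∑ j ∈ Finset.Icc 1 N, α j • (e j - e (j - 1)) =
      ∑ j ∈ Finset.Icc 1 N, ((α j).re + 1) • (e j - e (j - 1)) +
      Complex.I • ∑ j ∈ Finset.Icc 1 N, ((α j).im + 1) • (e j - e (j - 1)) -
      (1 + Complex.I) • e N := by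
    rw [← htel, Finset.smul_sum, Finset.smul_sum, ← Finset.sum_add_distrib,
      ← Finset.sum_sub_distrib]
    refine Finset.sum_congr rfl fun j _ => ?_
    rw [← Complex.coe_smul, ← Complex.coe_smul, smul_smul, ← add_smul, ← sub_smul]
    congr 1
    conv_lhs => rw [← Complex.re_add_im (α j)]
    push_cast
    ring
  have h1 := hreal (fun j => (α j).re) fun j => (Complex.abs_re_le_norm _).trans (hα j)
  have h2 : ‖Complex.I • ∑ j ∈ Finset.Icc 1 N, ((α j).im + 1) • (e j - e (j - 1))‖ ≤ 2 := by
    rw [norm_smul, Complex.norm_I, one_mul]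
    exact hreal (fun j => (α j).im) fun j => (Complex.abs_im_le_norm _).trans (hα j)
  have h3 : ‖(1 + Complex.I) • e N‖ ≤ 2 := by
    have hI : ‖1 + Complex.I‖ ≤ 2 := (norm_add_le _ _).trans (by norm_num)
    rw [norm_smul, ← mul_one 2]
    exact mul_le_mul hI (he.2.1 N) (norm_nonneg _) (by norm_num)
  rw [hsplit]
  exact (norm_sub_le_of_le (norm_add_le_of_le h1 h2) h3).trans (by norm_num)

theorem StrictlySumsTo.norm_le (he : IsApproximateUnit e) (he0 : e 0 = 0)
    (hee : ∀ n ≥ 1, e (n + 1) * e n = e n) (hα : ∀ j, ‖α j‖ ≤ 1)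
    (hY : StrictlySumsTo (fun j => α j • (e j - e (j - 1))) Y) : ‖Y‖ ≤ 6 := by
  refine norm_le_of_forall_mul_coe (by norm_num) fun x => ?_
  refine le_of_tendsto (hY x).1.norm (Filter.Eventually.of_forall fun N => ?_)
  refine norm_mul_le_of_le ?_ (norm_coe' x).le
  rw [norm_coe']
  exact he.norm_sum_le he0 hee hα N

theorem StrictlySumsTo.adjoint (he : IsApproximateUnit e)
    (hY : StrictlySumsTo (fun j => α j • (e j - e (j - 1))) Y) :
    StrictlySumsTo (fun j => star (α j) • (e j - e (j - 1))) (star Y) := by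
  have hsa (k : ℕ) : star (e k) = e k := (he.1 k).isSelfAdjoint
  have hsum (N : ℕ) : ∑ j ∈ Finset.Icc 1 N, star (α j) • (e j - e (j - 1)) =
      star (∑ j ∈ Finset.Icc 1 N, α j • (e j - e (j - 1))) := by
    simp only [star_sum, star_smul, star_sub, hsa]
  intro x
  have key := hY (star x)
  refine ⟨?_, ?_⟩
  · simpa only [hsum, coe_star', star_mul, star_star] using key.2.star
  · simpa only [hsum, coe_star', star_mul, star_star] using key.1.star

theorem StrictlySumsTo.coe_mul_mul_one_sub (he : IsApproximateUnit e) (he0 : e 0 = 0)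
    (hee : ∀ n ≥ 1, e (n + 1) * e n = e n)
    (hY : StrictlySumsTo (fun j => α j • (e j - e (j - 1))) Y) {N l : ℕ} (hl : N + 2 ≤ l) :
    (e N : 𝓜(ℂ, B)) * Y * (1 - (e l : 𝓜(ℂ, B))) = 0 := by
  have hmul {m n : ℕ} (h : m < n) : e m * e n = e m := he.mul_eq_left he0 hee h
  refine tendsto_nhds_unique ((hY (e N)).2.mul_const (1 - (e l : 𝓜(ℂ, B)))) ?_
  refine tendsto_const_nhds.congr fun K => ?_
  have hterm (j : ℕ) : e N * (e j - e (j - 1)) = e N * (e j - e (j - 1)) * e l := by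
    rcases lt_or_ge j (N + 2) with hj | hj
    · rw [mul_assoc, sub_mul, hmul (by omega : j < l), hmul (by omega : j - 1 < l)]
    · rw [mul_sub, hmul (by omega : N < j), hmul (by omega : N < j - 1)]
      simp
  rw [mul_sub, mul_one, ← coe_mul', ← coe_mul', ← coe_sub', ← coe_zero']
  congr 1
  simp only [Finset.mul_sum, Finset.sum_mul, mul_smul_comm, smul_mul_assoc]
  rw [← Finset.sum_sub_distrib]
  exact (Finset.sum_eq_zero fun j _ => by rw [← hterm j, sub_self]).symm

theorem StrictlySumsTo.sub_mul_one_sub (he : IsApproximateUnit e) (he0 : e 0 = 0)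
    (hee : ∀ n ≥ 1, e (n + 1) * e n = e n)
    (hY : StrictlySumsTo (fun j => α j • (e j - e (j - 1))) Y)
    (hY' : StrictlySumsTo (fun j => α' j • (e j - e (j - 1))) Y') {M l : ℕ}
    (hα : ∀ j ≥ M, α j = α' j) (hl : M ≤ l) :
    (Y - Y') * (1 - (e l : 𝓜(ℂ, B))) = 0 := by
  have hmul {m n : ℕ} (h : m < n) : e m * e n = e m := he.mul_eq_left he0 hee h
  refine norm_le_zero_iff.1 (norm_le_of_forall_mul_coe le_rfl fun x => ?_)
  rw [zero_mul, norm_le_zero_iff]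
  have hx : (1 - (e l : 𝓜(ℂ, B))) * (x : 𝓜(ℂ, B)) = ((x - e l * x : B) : 𝓜(ℂ, B)) := by
    rw [sub_mul, one_mul, coe_sub', coe_mul']
  rw [mul_assoc, hx, sub_mul]
  refine tendsto_nhds_unique ((hY (x - e l * x)).1.sub (hY' (x - e l * x)).1) ?_
  refine tendsto_const_nhds.congr fun K => ?_
  rw [← coe_mul', ← coe_mul', ← coe_sub', ← coe_zero', Finset.sum_mul, Finset.sum_mul,
    ← Finset.sum_sub_distrib]
  congr 1
  refine (Finset.sum_eq_zero fun j _ => ?_).symm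
  rcases lt_or_ge j M with hj | hj
  · have : (e j - e (j - 1)) * (x - e l * x) = 0 := by
      rw [mul_sub, ← mul_assoc, sub_mul _ _ (e l), hmul (by omega : j < l),
        hmul (by omega : j - 1 < l), sub_self]
    simp only [smul_mul_assoc, this, smul_zero, sub_zero]
  · rw [hα j hj, sub_self]

theorem IsApproximateUnit.norm_one_sub_le (he : IsApproximateUnit e) (l : ℕ) :
    ‖1 - (e l : 𝓜(ℂ, B))‖ ≤ ‖(1 : 𝓜(ℂ, B))‖ + 1 :=
  norm_sub_le_of_le le_rfl ((norm_coe' _).trans_le (he.2.1 l))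

variable {ι : Type*}

theorem IsApproximateUnit.compatibleWith_const (he : IsApproximateUnit e) (X : 𝓜(ℂ, B)) :
    CompatibleWith (fun n => (e n : 𝓜(ℂ, B))) (fun _ : ι => X) := by
  refine ⟨⟨_, fun _ => le_rfl⟩, fun N => ⟨⟨_, fun _ => le_rfl⟩, fun ε hε => ?_⟩⟩
  obtain ⟨L, hL⟩ := Filter.eventually_atTop.1 ((he.2.2.2 (X.snd (e N))).eventually_le_const hε)
  refine ⟨L, fun l hl _ => ?_⟩
  beta_reduce
  rw [coe_mul_eq_coe, mul_sub, mul_one, ← coe_mul', ← coe_sub', norm_coe', norm_sub_rev]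
  exact hL l hl

theorem IsApproximateUnit.compatibleWith_strictSums (he : IsApproximateUnit e) (he0 : e 0 = 0)
    (hee : ∀ n ≥ 1, e (n + 1) * e n = e n) {a : ι → ℕ → ℂ} (ha : ∀ i j, ‖a i j‖ ≤ 1)
    {y : ι → 𝓜(ℂ, B)}
    (hy : ∀ i, StrictlySumsTo (fun j => a i j • (e j - e (j - 1))) (y i)) :
    CompatibleWith (fun n => (e n : 𝓜(ℂ, B))) y := by
  have hb (i : ι) : ‖y i‖ ≤ 6 := (hy i).norm_le he he0 hee (ha i)
  refine ⟨⟨6, hb⟩, fun N => ⟨⟨_, fun i => norm_mul_le_of_le le_rfl (hb i)⟩, fun ε hε => ?_⟩⟩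
  refine ⟨N + 2, fun l hl i => ?_⟩
  rw [(hy i).coe_mul_mul_one_sub he he0 hee hl, norm_zero]
  exact hε.le

theorem IsApproximateUnit.vanishesUniformly_sub (he : IsApproximateUnit e) (he0 : e 0 = 0)
    (hee : ∀ n ≥ 1, e (n + 1) * e n = e n) {a a' : ι → ℕ → ℂ} (ha : ∀ i j, ‖a i j‖ ≤ 1)
    (ha' : ∀ i j, ‖a' i j‖ ≤ 1) {M : ℕ} (haa : ∀ i, ∀ j ≥ M, a i j = a' i j)
    {y y' : ι → 𝓜(ℂ, B)}
    (hy : ∀ i, StrictlySumsTo (fun j => a i j • (e j - e (j - 1))) (y i))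
    (hy' : ∀ i, StrictlySumsTo (fun j => a' i j • (e j - e (j - 1))) (y' i)) :
    VanishesUniformly (fun n => (e n : 𝓜(ℂ, B))) (fun i => y i - y' i) := by
  refine ⟨⟨6 + 6, fun i => norm_sub_le_of_le ((hy i).norm_le he he0 hee (ha i))
    ((hy' i).norm_le he he0 hee (ha' i))⟩, fun ε hε => ⟨M, fun l hl i => ?_⟩⟩
  rw [(hy i).sub_mul_one_sub he he0 hee (hy' i) (haa i) hl, norm_zero]
  exact hε.le

theorem IsApproximateUnit.vanishesUniformly_laurentEval_sub (he : IsApproximateUnit e)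
    (he0 : e 0 = 0) (hee : ∀ n ≥ 1, e (n + 1) * e n = e n) {a a' : ι → ℕ → ℂ}
    (ha : ∀ i j, ‖a i j‖ ≤ 1) (ha' : ∀ i j, ‖a' i j‖ ≤ 1) {M : ℕ}
    (haa : ∀ i, ∀ j ≥ M, a i j = a' i j) {y y' : ι → 𝓜(ℂ, B)}
    (hy : ∀ i, StrictlySumsTo (fun j => a i j • (e j - e (j - 1))) (y i))
    (hy' : ∀ i, StrictlySumsTo (fun j => a' i j • (e j - e (j - 1))) (y' i))
    (Nh Mh : ℕ) (β γ : ℕ → ℂ) (X : 𝓜(ℂ, B)) :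
    VanishesUniformly (fun n => (e n : 𝓜(ℂ, B)))
      (fun i => laurentEval Nh Mh β γ (y i * X) - laurentEval Nh Mh β γ (y' i * X)) := by
  have hK := he.norm_one_sub_le
  have hs (i : ι) := (hy i).adjoint he
  have hs' (i : ι) := (hy' i).adjoint he
  have hsa (i : ι) (j : ℕ) : ‖star (a i j)‖ ≤ 1 := (norm_star _).trans_le (ha i j)
  have hsa' (i : ι) (j : ℕ) : ‖star (a' i j)‖ ≤ 1 := (norm_star _).trans_le (ha' i j)
  have hX := he.compatibleWith_const (ι := ι) X
  have hXs := he.compatibleWith_const (ι := ι) (star X)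
  have hc := he.compatibleWith_strictSums he0 hee ha hy
  have hc' := he.compatibleWith_strictSums he0 hee ha' hy'
  have hcs := he.compatibleWith_strictSums he0 hee hsa hs
  have hcs' := he.compatibleWith_strictSums he0 hee hsa' hs'
  refine VanishesUniformly.laurentEval_sub hK ?_ (hc.mul hK hX).1 (hc'.mul hK hX) ?_ ?_ ?_
    Nh Mh β γ
  · simpa only [sub_mul] using
      (he.vanishesUniformly_sub he0 hee ha ha' haa hy hy').mul_right hK hX
  · simpa only [star_mul, mul_sub] using
      (he.vanishesUniformly_sub he0 hee hsa hsa'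
        (fun i j hj => congrArg star (haa i j hj)) hs hs').mul_left hXs.1
  · simpa only [star_mul] using (hXs.mul hK hcs).1
  · simpa only [star_mul] using hXs.mul hK hcs'

end ApproximateUnit

/-- Property A: for every Laurent polynomial `h`, every contractive
`X ∈ 𝓜(B)`, every `ε > 0` and every `M₀ ≥ 1`, there is `L₁ ≥ 1` such that for all
coefficient sequences in the closed unit ball of `ℂ` agreeing from `M₀` on, the
corresponding strict sums `Y`, `Y'` satisfy
`‖h(Y * X) * (1 - e L₁) - h(Y' * X) * (1 - e L₁)‖ < ε`. -/
theorem statement_6 {B : Type*} [NonUnitalCStarAlgebra B] [PartialOrder B] [StarOrderedRing B]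
    (hnonunital : ¬∃ u : B, ∀ b : B, u * b = b ∧ b * u = b)
    (hsimple : ∀ I : TwoSidedIdeal B, IsClosed (I : Set B) → I = ⊥ ∨ I = ⊤)
    (e : ℕ → B) (he : IsApproximateUnit e) (he0 : e 0 = 0)
    (hee : ∀ n ≥ 1, e (n + 1) * e n = e n)
    (Nh Mh : ℕ) (β γ : ℕ → ℂ)
    (X : 𝓜(ℂ, B)) (hX : ‖X‖ ≤ 1)
    (ε : ℝ) (hε : 0 < ε) (M₀ : ℕ) (hM₀ : 1 ≤ M₀) :
    ∃ L₁ ≥ 1, ∀ α α' : ℕ → ℂ, (∀ j, ‖α j‖ ≤ 1) → (∀ j, ‖α' j‖ ≤ 1) →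
      (∀ j ≥ M₀, α j = α' j) →
      ∀ Y Y' : 𝓜(ℂ, B),
        StrictlySumsTo (fun j => α j • (e j - e (j - 1))) Y →
        StrictlySumsTo (fun j => α' j • (e j - e (j - 1))) Y' →
        ‖laurentEval Nh Mh β γ (Y * X) * (1 - (e L₁ : 𝓜(ℂ, B))) -
          laurentEval Nh Mh β γ (Y' * X) * (1 - (e L₁ : 𝓜(ℂ, B)))‖ < ε := by
  let ι := {p : ((ℕ → ℂ) × (ℕ → ℂ)) × 𝓜(ℂ, B) × 𝓜(ℂ, B) //
    (∀ j, ‖p.1.1 j‖ ≤ 1) ∧ (∀ j, ‖p.1.2 j‖ ≤ 1) ∧ (∀ j ≥ M₀, p.1.1 j = p.1.2 j) ∧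
      StrictlySumsTo (fun j => p.1.1 j • (e j - e (j - 1))) p.2.1 ∧
      StrictlySumsTo (fun j => p.1.2 j • (e j - e (j - 1))) p.2.2}
  obtain ⟨L, hL⟩ := (he.vanishesUniformly_laurentEval_sub he0 hee (ι := ι)
    (fun i => i.2.1) (fun i => i.2.2.1) (fun i => i.2.2.2.1) (fun i => i.2.2.2.2.1)
    (fun i => i.2.2.2.2.2) Nh Mh β γ X).2 (ε / 2) (by positivity)
  refine ⟨max L 1, le_max_right _ _, fun α α' hα hα' hαα Y Y' hY hY' => ?_⟩
  rw [← sub_mul]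
  exact (hL _ (le_max_left _ _) ⟨((α, α'), (Y, Y')), hα, hα', hαα, hY, hY'⟩).trans_lt
    (half_lt_self hε)
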